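/- Let k be an algebraically closed field, d ≥ 2, and let U be the k-subalgebra of S(d)/K generated by the degree-1 elements m_{i,j,l} (i+j+l = d), where S(d) = k[x_i, y_i, z_i : 0 ≤ i ≤ d−1] and K is generated by x_i y_{i+1} − y_i x_{i+1}, y_i z_{i+1} − z_i y_{i+1}, z_i x_{i+1} (0 ≤ i ≤ d−2). Let m = U_+ be the irrelevant ideal, and let Γ_m(U)_1 = {f ∈ U_1 : m^n f = 0 for some n ∈ ℕ} be the degree-1 part of the m-torsion submodule (equal to H^0_m(U)_1). Then Γ_m(U)_1 = 0 if d = 2, and Γ_m(U)_1 = ⊕_{i,j,l ≥ 1, i+j+l = d} k·m_{i,j,l} if d ≥ 3. -/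

import Mathlib

/-!
Statement 13: For `A = k⟨x,y,z⟩/⟨xy−yx, yz−zy, zx⟩` and `d ≥ 2`, let `U` be the
subalgebra of `S(d)/K` generated by the degree-one elements `m_{i,j,l}`
(`i+j+l = d`), the model of `U_d(A)`.  Its degree-one component is
`U₁ = span_k {m_{i,j,l}}`.  An element `f ∈ U₁` is `m`-torsion for the
irrelevant ideal `m = U₊` iff some power of `U₊` annihilates it; since `U` is
generated in degree one this holds iff `U₁^n · f = 0` for some `n`.  The claim:
the degree-one part of the torsion submodule `H⁰_m(U)₁ = Γ_m(U)₁` is `0` when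
`d = 2`, and is `⊕_{i,j,l ≥ 1} k·m_{i,j,l}` (the span of the `m_{i,j,l}` with
`i, j, l ≥ 1`) when `d ≥ 3`.
-/

open MvPolynomial

noncomputable section

variable (k : Type) [Field k] (d : ℕ)

abbrev Sd := MvPolynomial (Fin d × Fin 3) k

def xv (i : Fin d) : Sd k d := X (i, 0)
def yv (i : Fin d) : Sd k d := X (i, 1)
def zv (i : Fin d) : Sd k d := X (i, 2)

def KK : Ideal (Sd k d) :=
  Ideal.span {p | ∃ (i : ℕ) (h : i + 1 < d),
    p = xv k d ⟨i, by omega⟩ * yv k d ⟨i + 1, h⟩ - yv k d ⟨i, by omega⟩ * xv k d ⟨i + 1, h⟩ ∨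
    p = yv k d ⟨i, by omega⟩ * zv k d ⟨i + 1, h⟩ - zv k d ⟨i, by omega⟩ * yv k d ⟨i + 1, h⟩ ∨
    p = zv k d ⟨i, by omega⟩ * xv k d ⟨i + 1, h⟩}

def mm (i j : ℕ) : Sd k d ⧸ KK k d :=
  Ideal.Quotient.mk (KK k d)
    (∏ t : Fin d, if (t : ℕ) < i then xv k d t else if (t : ℕ) < i + j then yv k d t
      else zv k d t)

/-- `U₁`: the span of the degree-one generators `m_{i,j,l}` of `U`. -/
def U1 : Submodule k (Sd k d ⧸ KK k d) :=
  Submodule.span k {q | ∃ i j l : ℕ, i + j + l = d ∧ q = mm k d i j}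

end

section TorsionHelpers

/-- Split the product of letters of the word `x⋯x y⋯y z⋯z` into its three blocks. -/
theorem prod_range_ite_blocks {R : Type*} [CommMonoid R] (x y z : ℕ → R) (i j l : ℕ) :
    (∏ t ∈ Finset.range (i + j + l), if t < i then x t else if t < i + j then y t else z t) =
      (∏ t ∈ Finset.range i, x t) * (∏ t ∈ Finset.range j, y (i + t)) *
        ∏ t ∈ Finset.range l, z (i + j + t) := by
  rw [Finset.prod_range_add, Finset.prod_range_add]
  congr 1
  · congr 1
    · exact Finset.prod_congr rfl fun t ht => by simp [Finset.mem_range.mp ht]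
    · exact Finset.prod_congr rfl fun t ht => by simp [Finset.mem_range.mp ht]
  · refine Finset.prod_congr rfl fun t _ => ?_
    rw [if_neg (by omega), if_neg (by omega)]

theorem prod_mul_shift {R : Type*} [CommRing R] (y z : ℕ → R)
    (hyz : ∀ t, y t * z (t + 1) = z t * y (t + 1)) (b n : ℕ) :
    (∏ t ∈ Finset.range n, y (b + t)) * z (b + n) =
      z b * ∏ t ∈ Finset.range n, y (b + 1 + t) := by
  induction n with
  | zero => simp
  | succ n ih =>
    have h := hyz (b + n)
    rw [Finset.prod_range_succ, Finset.prod_range_succ,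
      show b + 1 + n = b + n + 1 by omega, ← mul_assoc (z b), ← ih, ← add_assoc]
    linear_combination (∏ t ∈ Finset.range n, y (b + t)) * h

/-- A word with all three letters is killed by every letter in the position of its first `y`. -/
theorem interior_word_mul_letter {R : Type*} [CommRing R] (x y z : ℕ → R)
    (hxy : ∀ t, x t * y (t + 1) = y t * x (t + 1))
    (hyz : ∀ t, y t * z (t + 1) = z t * y (t + 1))
    (hzx : ∀ t, z t * x (t + 1) = 0) (i j l : ℕ) {s : R}
    (hs : s = x (i + 1) ∨ s = y (i + 1) ∨ s = z (i + 1)) :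
    s * ((∏ t ∈ Finset.range (i + 1), x t) * (∏ t ∈ Finset.range (j + 1), y (i + 1 + t)) *
        ∏ t ∈ Finset.range (l + 1), z (i + 1 + (j + 1) + t)) = 0 := by
  have key : x i * y (i + 1) * z (i + 1 + 1) * s = 0 := by
    have h1 := hxy i
    have h2 := hyz i
    have h3 := hzx i
    have h4 := hxy (i + 1)
    have h5 := hyz (i + 1)
    have h6 := hzx (i + 1)
    rcases hs with rfl | rfl | rfl
    · linear_combination x i * x (i + 1) * h5 + x i * z (i + 1) * h4 + x i * y (i + 1) * h6
    · linear_combination x i * y (i + 1) * h5 + z (i + 1) * y (i + 1 + 1) * h1 +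
        y i * z (i + 1) * h4 + y i * y (i + 1) * h6
    · linear_combination z (i + 1) * z (i + 1 + 1) * h1 + x (i + 1) * z (i + 1 + 1) * h2 +
        y (i + 1) * z (i + 1 + 1) * h3
  have hshift := prod_mul_shift y z hyz (i + 1 + 1) j
  rw [Finset.prod_range_succ x, Finset.prod_range_succ' (fun t => y (i + 1 + t)),
    Finset.prod_range_succ' (fun t => z (i + 1 + (j + 1) + t))]
  have hy : ∀ t, y (i + 1 + (t + 1)) = y (i + 1 + 1 + t) := fun t => congrArg y (by omega)
  have hz : z (i + 1 + (j + 1)) = z (i + 1 + 1 + j) := congrArg z (by omega)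
  simp only [hy, hz, add_zero]
  linear_combination s * (∏ t ∈ Finset.range i, x t) * x i * y (i + 1) *
      (∏ t ∈ Finset.range l, z (i + 1 + (j + 1) + (t + 1))) * hshift +
    (∏ t ∈ Finset.range i, x t) * (∏ t ∈ Finset.range j, y (i + 1 + 1 + 1 + t)) *
      (∏ t ∈ Finset.range l, z (i + 1 + (j + 1) + (t + 1))) * key

variable (k : Type) [Field k] (d : ℕ)

/-- The class of the letter `c` in position `t`, extended by zero beyond position `d - 1`. -/
noncomputable def letterClass (c : Fin 3) (t : ℕ) : Sd k d ⧸ KK k d :=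
  if h : t < d then Ideal.Quotient.mk (KK k d) (X (⟨t, h⟩, c)) else 0

theorem letterClass_relations (t : ℕ) :
    letterClass k d 0 t * letterClass k d 1 (t + 1) =
        letterClass k d 1 t * letterClass k d 0 (t + 1) ∧
      letterClass k d 1 t * letterClass k d 2 (t + 1) =
        letterClass k d 2 t * letterClass k d 1 (t + 1) ∧
      letterClass k d 2 t * letterClass k d 0 (t + 1) = 0 := by
  by_cases h : t + 1 < d
  · have ht : t < d := by omega
    simp only [letterClass, h, ht, dif_pos, ← map_mul]
    refine ⟨?_, ?_, ?_⟩
    · exact Ideal.Quotient.eq.mpr (Ideal.subset_span ⟨t, h, Or.inl rfl⟩)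
    · exact Ideal.Quotient.eq.mpr (Ideal.subset_span ⟨t, h, Or.inr (Or.inl rfl)⟩)
    · exact Ideal.Quotient.eq_zero_iff_mem.mpr
        (Ideal.subset_span ⟨t, h, Or.inr (Or.inr rfl)⟩)
  · have hz : ∀ c, letterClass k d c (t + 1) = 0 := fun c => dif_neg h
    simp only [hz, mul_zero, and_self]

theorem mm_eq_prod_range (i j : ℕ) :
    mm k d i j = ∏ t ∈ Finset.range d, if t < i then letterClass k d 0 t
      else if t < i + j then letterClass k d 1 t else letterClass k d 2 t := by
  rw [Finset.prod_range, mm, map_prod]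
  refine Finset.prod_congr rfl fun t _ => ?_
  simp only [letterClass, t.isLt, dif_pos]
  split_ifs <;> rfl

theorem mm_mul_interior_mm (a b : ℕ) {i j l : ℕ} (h : i + j + l = d)
    (hi : 1 ≤ i) (hj : 1 ≤ j) (hl : 1 ≤ l) : mm k d a b * mm k d i j = 0 := by
  obtain ⟨i, rfl⟩ := Nat.exists_eq_add_of_le' hi
  obtain ⟨j, rfl⟩ := Nat.exists_eq_add_of_le' hj
  obtain ⟨l, rfl⟩ := Nat.exists_eq_add_of_le' hl
  have hmem : i + 1 ∈ Finset.range d := Finset.mem_range.mpr (by omega)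
  obtain ⟨q, hq⟩ := Finset.dvd_prod_of_mem (fun t => if t < a then letterClass k d 0 t
      else if t < a + b then letterClass k d 1 t else letterClass k d 2 t) hmem
  have hm : mm k d (i + 1) (j + 1) =
      (∏ t ∈ Finset.range (i + 1), letterClass k d 0 t) *
        (∏ t ∈ Finset.range (j + 1), letterClass k d 1 (i + 1 + t)) *
        ∏ t ∈ Finset.range (l + 1), letterClass k d 2 (i + 1 + (j + 1) + t) := by
    rw [mm_eq_prod_range, ← prod_range_ite_blocks, h]
  rw [mm_eq_prod_range k d a b, hq, mul_right_comm, hm, interior_word_mul_letter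
    (letterClass k d 0) (letterClass k d 1) (letterClass k d 2)
    (fun t => (letterClass_relations k d t).1) (fun t => (letterClass_relations k d t).2.1)
    (fun t => (letterClass_relations k d t).2.2) i j l, zero_mul]
  split_ifs <;> simp

theorem mul_eq_zero_of_mem_interior_span {g f : Sd k d ⧸ KK k d} (hg : g ∈ U1 k d)
    (hf : f ∈ Submodule.span k {q | ∃ i j l : ℕ, i + j + l = d ∧
      1 ≤ i ∧ 1 ≤ j ∧ 1 ≤ l ∧ q = mm k d i j}) : g * f = 0 := by
  induction hf using Submodule.span_induction with
  | zero => simp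
  | add u v _ _ hu hv => rw [mul_add, hu, hv, add_zero]
  | smul c u _ hu => rw [mul_smul_comm, hu, smul_zero]
  | mem u hu =>
    obtain ⟨i, j, l, h, hi, hj, hl, rfl⟩ := hu
    induction hg using Submodule.span_induction with
    | zero => simp
    | add u v _ _ hu hv => rw [add_mul, hu, hv, add_zero]
    | smul c u _ hu => rw [smul_mul_assoc, hu, smul_zero]
    | mem u hu =>
      obtain ⟨a, b, _, _, rfl⟩ := hu
      exact mm_mul_interior_mm k d a b h hi hj hl

theorem exists_algHom_of_relations {B : Type*} [CommRing B] [Algebra k B] (x y z : ℕ → B)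
    (hxy : ∀ t, x t * y (t + 1) = y t * x (t + 1))
    (hyz : ∀ t, y t * z (t + 1) = z t * y (t + 1))
    (hzx : ∀ t, z t * x (t + 1) = 0) :
    ∃ φ : (Sd k d ⧸ KK k d) →ₐ[k] B, ∀ i j l, i + j + l = d →
      φ (mm k d i j) = (∏ t ∈ Finset.range i, x t) * (∏ t ∈ Finset.range j, y (i + t)) *
        ∏ t ∈ Finset.range l, z (i + j + t) := by
  let ψ : Sd k d →ₐ[k] B := aeval fun p => ![x p.1, y p.1, z p.1] p.2
  have hψ : ∀ p ∈ KK k d, ψ p = 0 := by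
    intro p hp
    have hle : KK k d ≤ RingHom.ker ψ := by
      refine Ideal.span_le.mpr ?_
      rintro _ ⟨t, h, rfl | rfl | rfl⟩ <;>
        simp [ψ, xv, yv, zv, RingHom.mem_ker, hxy, hyz, hzx]
    exact hle hp
  refine ⟨Ideal.Quotient.liftₐ (KK k d) ψ hψ, fun i j l h => ?_⟩
  rw [← prod_range_ite_blocks, h, Finset.prod_range, mm]
  change ψ _ = _
  rw [map_prod]
  refine Finset.prod_congr rfl fun t _ => ?_
  split_ifs <;> simp [ψ, xv, yv, zv]

/-- Each `m_{i,j,l}` with a zero index is separated from the others by a coefficient of a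
`k[T]`-valued point. -/
theorem exists_separating_algHom {i₀ j₀ : ℕ} (h₀ : i₀ + j₀ ≤ d)
    (hb : i₀ = 0 ∨ j₀ = 0 ∨ i₀ + j₀ = d) :
    ∃ φ : (Sd k d ⧸ KK k d) →ₐ[k] Polynomial k, ∀ i j, i + j ≤ d →
      (φ (mm k d i j)).coeff j₀ = if i = i₀ ∧ j = j₀ then 1 else 0 := by
  rcases hb with rfl | rfl | hd
  · obtain ⟨φ, hφ⟩ := exists_algHom_of_relations k d (fun _ => (0 : Polynomial k))
      (fun _ => Polynomial.X) (fun _ => 1) (by simp) (by simp) (by simp)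
    refine ⟨φ, fun i j hij => ?_⟩
    obtain ⟨l, hl⟩ := Nat.exists_eq_add_of_le hij
    rw [hφ i j l hl.symm]
    rcases Nat.eq_zero_or_pos i with rfl | hi
    · simp [Polynomial.coeff_X_pow, eq_comm]
    · simp [hi.ne']
  · obtain ⟨φ, hφ⟩ := exists_algHom_of_relations k d
      (fun t => if t < i₀ then (1 : Polynomial k) else 0)
      (fun _ => 0) (fun t => if t < i₀ then 0 else 1) (by simp) (by simp)
      (fun t => by split_ifs <;> first | omega | simp)
    refine ⟨φ, fun i j hij => ?_⟩
    obtain ⟨l, hl⟩ := Nat.exists_eq_add_of_le hij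
    rw [hφ i j l hl.symm]
    rcases Nat.eq_zero_or_pos j with rfl | hj
    · rcases lt_trichotomy i i₀ with hi | rfl | hi
      · rw [Finset.prod_eq_zero (i := 0) (s := Finset.range l)
          (Finset.mem_range.mpr (by omega)) (by simp [hi])]
        simp [hi.ne]
      · rw [Finset.prod_eq_one (s := Finset.range i)
          (fun t ht => if_pos (Finset.mem_range.mp ht))]
        simp
      · rw [Finset.prod_eq_zero (i := i₀) (s := Finset.range i)
          (Finset.mem_range.mpr hi) (by simp)]
        simp [hi.ne']
    · simp [hj.ne']
  · obtain ⟨φ, hφ⟩ := exists_algHom_of_relations k d (fun _ => (1 : Polynomial k))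
      (fun _ => Polynomial.X) (fun _ => 0) (by simp) (by simp) (by simp)
    refine ⟨φ, fun i j hij => ?_⟩
    obtain ⟨l, hl⟩ := Nat.exists_eq_add_of_le hij
    rw [hφ i j l hl.symm]
    rcases Nat.eq_zero_or_pos l with rfl | hl'
    · have : (i = i₀ ∧ j = j₀) ↔ j₀ = j := by omega
      simp [Polynomial.coeff_X_pow, this]
    · have : ¬ (i = i₀ ∧ j = j₀) := by omega
      simp [hl'.ne', this]

theorem mem_interior_span_of_torsion {f : Sd k d ⧸ KK k d} (hf : f ∈ U1 k d) {n : ℕ}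
    (hn : ∀ g ∈ (U1 k d) ^ n, g * f = 0) :
    f ∈ Submodule.span k {q | ∃ i j l : ℕ, i + j + l = d ∧
      1 ≤ i ∧ 1 ≤ j ∧ 1 ≤ l ∧ q = mm k d i j} := by
  let ι := {p : Fin (d + 1) × Fin (d + 1) // (p.1 : ℕ) + p.2 ≤ d}
  have hU : U1 k d ≤ Submodule.span k
      (Set.range fun p : ι => mm k d (p.1.1 : ℕ) (p.1.2 : ℕ)) := by
    refine Submodule.span_mono ?_
    rintro _ ⟨i, j, l, h, rfl⟩
    exact ⟨⟨(⟨i, by omega⟩, ⟨j, by omega⟩), by simp; omega⟩, rfl⟩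
  obtain ⟨c, rfl⟩ := (Submodule.mem_span_range_iff_exists_fun k).mp (hU hf)
  refine Submodule.sum_mem _ fun p _ => ?_
  by_cases hb : (p.1.1 : ℕ) = 0 ∨ (p.1.2 : ℕ) = 0 ∨ (p.1.1 : ℕ) + p.1.2 = d
  · obtain ⟨φ, hφ⟩ := exists_separating_algHom k d p.2 hb
    have hp : mm k d (p.1.1 : ℕ) (p.1.2 : ℕ) ∈ U1 k d :=
      Submodule.subset_span ⟨_, _, d - (p.1.1 + p.1.2), by have := p.2; omega, rfl⟩
    have hne : φ (mm k d (p.1.1 : ℕ) (p.1.2 : ℕ)) ≠ 0 := by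
      intro h0
      have := hφ _ _ p.2
      simp [h0] at this
    have h := congrArg φ (hn _ (Submodule.pow_mem_pow _ hp n))
    rw [map_mul, map_pow, map_zero] at h
    have h' := (mul_eq_zero.mp h).resolve_left (pow_ne_zero n hne)
    have hc := congrArg (fun q => Polynomial.coeff q (p.1.2 : ℕ)) h'
    simp only [map_sum, map_smul, Polynomial.finsetSum_coeff, Polynomial.coeff_smul,
      Polynomial.coeff_zero, smul_eq_mul] at hc
    rw [Finset.sum_eq_single p] at hc
    · rw [hφ _ _ p.2] at hc
      have : c p = 0 := by simpa using hc
      simp [this]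
    · intro q _ hq
      rw [hφ _ _ q.2, if_neg, mul_zero]
      rintro ⟨h1, h2⟩
      exact hq (Subtype.ext (Prod.ext (Fin.ext h1) (Fin.ext h2)))
    · simp
  · refine Submodule.smul_mem _ _ (Submodule.subset_span
      ⟨p.1.1, p.1.2, d - (p.1.1 + p.1.2), ?_, ?_, ?_, ?_, rfl⟩) <;>
    have := p.2 <;> omega

theorem torsion_iff_mem_interior_span {f : Sd k d ⧸ KK k d} (hf : f ∈ U1 k d) :
    (∃ n : ℕ, ∀ g ∈ (U1 k d) ^ n, g * f = 0) ↔
      f ∈ Submodule.span k {q | ∃ i j l : ℕ, i + j + l = d ∧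
        1 ≤ i ∧ 1 ≤ j ∧ 1 ≤ l ∧ q = mm k d i j} :=
  ⟨fun ⟨_, hn⟩ => mem_interior_span_of_torsion k d hf hn,
    fun h => ⟨1, fun _ hg => mul_eq_zero_of_mem_interior_span k d ((Submodule.pow_one (U1 k d)).le hg) h⟩⟩

end TorsionHelpers

theorem statement_13 (k : Type) [Field k] [IsAlgClosed k] (d : ℕ) (hd : 2 ≤ d) :
    (d = 2 → ∀ f ∈ U1 k d,
      ((∃ n : ℕ, ∀ g ∈ (U1 k d) ^ n, g * f = 0) ↔ f = 0)) ∧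
    (3 ≤ d → ∀ f ∈ U1 k d,
      ((∃ n : ℕ, ∀ g ∈ (U1 k d) ^ n, g * f = 0) ↔
        f ∈ Submodule.span k {q | ∃ i j l : ℕ, i + j + l = d ∧
          1 ≤ i ∧ 1 ≤ j ∧ 1 ≤ l ∧ q = mm k d i j})) := by
  refine ⟨fun h2 f hf => ?_, fun _ f hf => torsion_iff_mem_interior_span k d hf⟩
  have hempty : {q | ∃ i j l : ℕ, i + j + l = d ∧
      1 ≤ i ∧ 1 ≤ j ∧ 1 ≤ l ∧ q = mm k d i j} = ∅ := by
    refine Set.eq_empty_of_forall_notMem ?_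
    rintro q ⟨i, j, l, h, hi, hj, hl, -⟩
    omega
  rw [torsion_iff_mem_interior_span k d hf, hempty, Submodule.span_empty, Submodule.mem_bot]
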